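/- Let A be an integer matrix with q columns and let Δ(A) be the maximum absolute value of the determinant of a square submatrix of A. Then every element g of the Graver basis of A satisfies ‖g‖_∞ ≤ q · Δ(A). -/

import Mathlib

def SignCompat {n : ℕ} (a b : Fin n → ℤ) : Prop := ∀ i, 0 ≤ a i * b i

def Conforms {n : ℕ} (a b : Fin n → ℤ) : Prop :=
  SignCompat a b ∧ ∀ i, |a i| ≤ |b i|

def InGraver {m n : ℕ} (A : Matrix (Fin m) (Fin n) ℤ) (g : Fin n → ℤ) : Prop :=
  g ≠ 0 ∧ A.mulVec g = 0 ∧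
    ∀ h : Fin n → ℤ, h ≠ 0 → A.mulVec h = 0 → Conforms h g → h = g

/-- A multiple of `z` can be subtracted from `x` so that no sign changes and the support shrinks. -/
lemma exists_sub_smul_support_lt {q : ℕ} (x z : Fin q → ℚ) (h : ∃ i, 0 < x i * z i) :
    ∃ t : ℚ, 0 < t ∧ (∀ i, 0 ≤ (x i - t * z i) * x i) ∧ ∃ i, x i ≠ 0 ∧ x i - t * z i = 0 := by
  classical
  obtain ⟨i₀, hi₀⟩ := h
  obtain ⟨i, hi, hmin⟩ := Finset.exists_min_image (Finset.univ.filter fun i => 0 < x i * z i)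
    (fun i => x i / z i) ⟨i₀, by simpa using hi₀⟩
  simp only [Finset.mem_filter, Finset.mem_univ, true_and] at hi hmin
  have hx : x i ≠ 0 := left_ne_zero_of_mul hi.ne'
  have hz : z i ≠ 0 := right_ne_zero_of_mul hi.ne'
  have ht : 0 < x i / z i := by
    rw [← mul_div_mul_right (x i) (z i) hz]
    exact div_pos hi (mul_self_pos.2 hz)
  refine ⟨x i / z i, ht, fun j => ?_, i, hx, by field_simp; ring⟩
  by_cases hj : 0 < x j * z j
  · have hzj : z j ≠ 0 := right_ne_zero_of_mul hj.ne'
    have h1 : x i / z i * (x j * z j) ≤ x j / z j * (x j * z j) :=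
      mul_le_mul_of_nonneg_right (hmin j hj) hj.le
    have h2 : x j / z j * (x j * z j) = x j * x j := by field_simp
    nlinarith
  · nlinarith [mul_nonneg ht.le (neg_nonneg.2 (not_lt.1 hj)), mul_self_nonneg (x j)]

lemma exists_injective_submatrix_det_ne_zero {K : Type*} [Field K] {m s : ℕ}
    (M : Matrix (Fin m) (Fin s) K) (hM : LinearIndependent K M.col) :
    ∃ r : Fin s → Fin m, Function.Injective r ∧ (M.submatrix r id).det ≠ 0 := by
  obtain ⟨κ, a, ha, hsp, hli⟩ := exists_linearIndependent' K M.row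
  have : Finite κ := Finite.of_injective a ha
  have : Fintype κ := Fintype.ofFinite κ
  have hrank : M.rank = s := by
    rw [← Matrix.rank_transpose]
    simpa using LinearIndependent.rank_matrix (M := M.transpose) hM
  have hcard : Fintype.card κ = s := by
    rw [linearIndependent_iff_card_eq_finrank_span.1 hli, Set.finrank, hsp,
      ← Matrix.rank_eq_finrank_span_row, hrank]
  let e : Fin s ≃ κ := (Fintype.equivFinOfCardEq hcard).symm
  refine ⟨a ∘ e, ha.comp e.injective, ?_⟩
  have h : LinearIndependent K (M.submatrix (a ∘ e) id).row := hli.comp e e.injective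
  exact ((Matrix.isUnit_iff_isUnit_det _).1 (Matrix.linearIndependent_rows_iff_isUnit.1 h)).ne_zero

/-- Every nonzero kernel vector conforms to a nonzero kernel vector whose support is minimal. -/
lemma exists_elementary {m q : ℕ} (A : Matrix (Fin m) (Fin q) ℚ) (x : Fin q → ℚ)
    (hx : x ≠ 0) (hAx : A.mulVec x = 0) :
    ∃ y : Fin q → ℚ, y ≠ 0 ∧ A.mulVec y = 0 ∧ (∀ i, 0 ≤ y i * x i) ∧
      (∀ i, x i = 0 → y i = 0) ∧
      ∀ z : Fin q → ℚ, A.mulVec z = 0 → (∀ i, y i = 0 → z i = 0) → ∃ t : ℚ, z = t • y := by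
  classical
  induction hn : (Finset.univ.filter fun i => x i ≠ 0).card using Nat.strong_induction_on
    generalizing x with
  | _ n ih =>
    by_cases hmin : ∀ z : Fin q → ℚ, A.mulVec z = 0 → (∀ i, x i = 0 → z i = 0) →
        ∃ t : ℚ, z = t • x
    · exact ⟨x, hx, hAx, fun i => mul_self_nonneg _, fun _ h => h, hmin⟩
    push Not at hmin
    obtain ⟨z, hAz, hsupp, hz⟩ := hmin
    have key : ∃ z : Fin q → ℚ, A.mulVec z = 0 ∧ (∀ i, x i = 0 → z i = 0) ∧
        (∀ t : ℚ, z ≠ t • x) ∧ ∃ i, 0 < x i * z i := by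
      obtain ⟨i, hi⟩ : ∃ i, z i ≠ 0 := by
        by_contra! h
        exact hz 0 (by ext i; simp [h i])
      have hxi : x i ≠ 0 := fun h => hi (hsupp i h)
      rcases lt_or_gt_of_ne (mul_ne_zero hxi hi) with h | h
      · refine ⟨-z, by rw [Matrix.mulVec_neg, hAz, neg_zero], fun j hj => by simp [hsupp j hj],
          fun t ht => hz (-t) (by rw [neg_smul, ← ht, neg_neg]), i, ?_⟩
        simpa using h
      · exact ⟨z, hAz, hsupp, hz, i, h⟩
    obtain ⟨z, hAz, hsupp, hz, hpos⟩ := key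
    obtain ⟨t, ht, hcompat, i, hxi, hwi⟩ := exists_sub_smul_support_lt x z hpos
    have hw : x - t • z ≠ 0 := fun h => hz t⁻¹ (by
      rw [sub_eq_zero.1 h, smul_smul, inv_mul_cancel₀ ht.ne', one_smul])
    have hws : ∀ j, x j = 0 → (x - t • z) j = 0 := fun j hj => by simp [hj, hsupp j hj]
    have hAw : A.mulVec (x - t • z) = 0 := by
      rw [Matrix.mulVec_sub, Matrix.mulVec_smul, hAx, hAz]; simp
    have hlt : (Finset.univ.filter fun j => (x - t • z) j ≠ 0).card < n := by
      rw [← hn]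
      refine Finset.card_lt_card (Finset.ssubset_iff_of_subset ?_ |>.2 ⟨i, ?_, ?_⟩)
      · intro j
        simpa only [Finset.mem_filter, Finset.mem_univ, true_and] using mt (hws j)
      · simpa using hxi
      · simpa using hwi
    obtain ⟨y, hy, hAy, hyw, hys, hyz⟩ := ih _ hlt (x - t • z) hw hAw rfl
    refine ⟨y, hy, hAy, fun j => ?_, fun j hj => hys j (hws j hj), hyz⟩
    by_cases h0 : (x - t • z) j = 0
    · simp [hys j h0]
    · have h1 := mul_nonneg (hyw j) (hcompat j)
      have h2 : 0 < (x - t • z) j * (x - t • z) j := mul_self_pos.2 h0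
      have h3 : y j * (x - t • z) j * ((x j - t * z j) * x j) =
          (y j * x j) * ((x - t • z) j * (x - t • z) j) := by
        simp only [Pi.sub_apply, Pi.smul_apply, smul_eq_mul]; ring
      rw [h3] at h1
      exact nonneg_of_mul_nonneg_left h1 h2

/-- A kernel vector of minimal support is proportional to an integer vector of minors. -/
lemma exists_int_smul_of_elementary {m q : ℕ} (A : Matrix (Fin m) (Fin q) ℤ) (Δ : ℤ)
    (hΔ : ∀ (s : ℕ) (r : Fin s → Fin m) (c : Fin s → Fin q),
      Function.Injective r → Function.Injective c → |(A.submatrix r c).det| ≤ Δ)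
    (y : Fin q → ℚ) (hy : y ≠ 0) (hAy : (A.map (Int.cast : ℤ → ℚ)).mulVec y = 0)
    (hmin : ∀ z : Fin q → ℚ, (A.map (Int.cast : ℤ → ℚ)).mulVec z = 0 →
      (∀ i, y i = 0 → z i = 0) → ∃ t : ℚ, z = t • y) :
    ∃ (u : Fin q → ℤ) (t : ℚ), t ≠ 0 ∧ (∀ i, (u i : ℚ) = t * y i) ∧ ∀ i, |u i| ≤ Δ := by
  classical
  obtain ⟨i₀, hi₀⟩ := Function.ne_iff.1 hy
  simp only [Pi.zero_apply] at hi₀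
  let S : Finset (Fin q) := Finset.univ.filter fun i => y i ≠ 0 ∧ i ≠ i₀
  let c : Fin S.card → Fin q := fun j => (S.equivFin.symm j : Fin q)
  have hc : Function.Injective c := Subtype.val_injective.comp S.equivFin.symm.injective
  have hcS : ∀ j, y (c j) ≠ 0 ∧ c j ≠ i₀ := fun j => by
    exact (Finset.mem_filter.1 (S.equivFin.symm j).2).2
  have hrange : ∀ i, y i ≠ 0 → i ≠ i₀ → ∃ j, c j = i := fun i h1 h2 =>
    ⟨S.equivFin ⟨i, by simp [S, h1, h2]⟩, by simp [c]⟩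
  have hli : LinearIndependent ℚ ((A.map (Int.cast : ℤ → ℚ)).submatrix id c).col := by
    rw [Fintype.linearIndependent_iff]
    intro a ha
    obtain ⟨t, ht⟩ := hmin (Function.extend c a 0) (by
        ext k
        have := congrFun ha k
        simp only [Finset.sum_apply, Pi.smul_apply, smul_eq_mul, Pi.zero_apply] at this
        rw [Pi.zero_apply, ← this]
        refine (Fintype.sum_of_injective c hc _ _ (fun i hi => ?_) fun j => ?_).symm
        · rw [Function.extend_apply' _ _ _ (by simpa using hi)]; simp
        · rw [hc.extend_apply]; simp [mul_comm])
      (fun i hi => by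
        rw [Function.extend_apply' _ _ _ (by rintro ⟨j, rfl⟩; exact (hcS j).1 hi)]; rfl)
    have h0 : t * y i₀ = 0 := by
      have := congrFun ht i₀
      rw [Function.extend_apply' _ _ _ (by rintro ⟨j, hj⟩; exact (hcS j).2 hj)] at this
      simpa using this.symm
    have ht0 : t = 0 := (mul_eq_zero.1 h0).resolve_right hi₀
    intro j
    have := congrFun ht (c j)
    rw [hc.extend_apply] at this
    simpa [ht0] using this
  obtain ⟨r, hr, hdet⟩ := exists_injective_submatrix_det_ne_zero _ hli
  let B : Matrix (Fin S.card) (Fin S.card) ℤ := A.submatrix r c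
  let b : Fin S.card → ℤ := fun k => A (r k) i₀
  let BQ : Matrix (Fin S.card) (Fin S.card) ℚ := B.map (Int.cast : ℤ → ℚ)
  have hBQ : (B.det : ℚ) = BQ.det := Int.cast_det B
  have hB : (B.det : ℚ) ≠ 0 := by rw [hBQ]; exact hdet
  have hBy : BQ.mulVec (y ∘ c) = (-y i₀) • fun k => (b k : ℚ) := by
    ext k
    have h1 := congrFun hAy (r k)
    simp only [Matrix.mulVec, dotProduct, Pi.zero_apply] at h1
    rw [← Finset.add_sum_erase _ _ (Finset.mem_univ i₀)] at h1
    have h2 : (BQ.mulVec (y ∘ c)) k = ∑ i ∈ Finset.univ.erase i₀,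
        (A.map (Int.cast : ℤ → ℚ)) (r k) i * y i := by
      simp only [Matrix.mulVec, dotProduct]
      refine Finset.sum_of_injOn c hc.injOn (fun j _ => by simp [(hcS j).2]) ?_ fun j _ => by
        simp [BQ, B]
      intro i hi hni
      by_cases hyi : y i = 0
      · simp [hyi]
      · obtain ⟨j, hj⟩ := hrange i hyi (Finset.ne_of_mem_erase hi)
        exact absurd ⟨j, by simp, hj⟩ hni
    rw [h2]
    simp only [Matrix.map_apply, Pi.smul_apply, smul_eq_mul, b] at h1 ⊢
    linarith
  have hcr : ∀ j, (B.det : ℚ) * y (c j) = -y i₀ * (B.cramer b j : ℚ) := fun j => by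
    have h1 := congrArg BQ.adjugate.mulVec hBy
    rw [Matrix.mulVec_mulVec, Matrix.adjugate_mul, Matrix.smul_mulVec, Matrix.one_mulVec,
      Matrix.mulVec_smul, ← Matrix.cramer_eq_adjugate_mulVec] at h1
    have h2 := congrFun h1 j
    simp only [Pi.smul_apply, smul_eq_mul, Function.comp_apply, Matrix.cramer_apply] at h2
    rw [hBQ, h2, Matrix.cramer_apply, Int.cast_det]
    congr 2
    ext k l
    by_cases hl : l = j
    · subst hl; simp
    · simp [hl, BQ]
  refine ⟨Function.update (Function.extend c (fun j => -B.cramer b j) 0) i₀ B.det,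
    B.det / y i₀, div_ne_zero hB hi₀, fun i => ?_, fun i => ?_⟩
  · by_cases hi : i = i₀
    · subst hi; simp [hi₀]
    rw [Function.update_of_ne hi]
    by_cases hyi : y i = 0
    · rw [Function.extend_apply' _ _ _ (by rintro ⟨j, rfl⟩; exact (hcS j).1 hyi)]
      simp [hyi]
    obtain ⟨j, rfl⟩ := hrange i hyi hi
    rw [hc.extend_apply, div_mul_eq_mul_div, hcr j]
    push_cast
    field_simp
  · have h0 : 0 ≤ Δ := (abs_nonneg _).trans (hΔ _ r c hr hc)
    by_cases hi : i = i₀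
    · subst hi; simpa using hΔ _ r c hr hc
    rw [Function.update_of_ne hi]
    by_cases hyi : y i = 0
    · rw [Function.extend_apply' _ _ _ (by rintro ⟨j, rfl⟩; exact (hcS j).1 hyi)]
      simpa using h0
    obtain ⟨j, rfl⟩ := hrange i hyi hi
    rw [hc.extend_apply, abs_neg, Matrix.cramer_apply]
    have hsub : B.updateCol j b = A.submatrix r (Function.update c j i₀) := by
      ext k l
      by_cases hl : l = j
      · subst hl; simp [b]
      · simp [hl, B]
    rw [hsub]
    refine hΔ _ r _ hr fun k l hkl => ?_
    by_cases hk : k = j <;> by_cases hl : l = j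
    · rw [hk, hl]
    · subst hk; simp [hl] at hkl; exact absurd hkl.symm (hcS l).2
    · subst hl; simp [hk] at hkl; exact absurd hkl (hcS k).2
    · simp only [Function.update_of_ne hk, Function.update_of_ne hl] at hkl
      exact hc hkl

/-- Every nonzero rational kernel vector has a conformal integer kernel vector bounded by the
minors of the matrix. -/
lemma exists_conformal_int_kernel_vector {m q : ℕ} (A : Matrix (Fin m) (Fin q) ℤ) (Δ : ℤ)
    (hΔ : ∀ (s : ℕ) (r : Fin s → Fin m) (c : Fin s → Fin q),
      Function.Injective r → Function.Injective c → |(A.submatrix r c).det| ≤ Δ)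
    (x : Fin q → ℚ) (hx : x ≠ 0) (hAx : (A.map (Int.cast : ℤ → ℚ)).mulVec x = 0) :
    ∃ u : Fin q → ℤ, u ≠ 0 ∧ (A.map (Int.cast : ℤ → ℚ)).mulVec (fun i => (u i : ℚ)) = 0 ∧
      (∀ i, 0 ≤ x i * u i) ∧ (∀ i, x i = 0 → u i = 0) ∧ ∀ i, |u i| ≤ Δ := by
  obtain ⟨y, hy, hAy, hyx, hys, hmin⟩ := exists_elementary _ x hx hAx
  have key : ∃ (u : Fin q → ℤ) (t : ℚ), 0 < t ∧ (∀ i, (u i : ℚ) = t * y i) ∧ ∀ i, |u i| ≤ Δ := by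
    obtain ⟨u, t, ht, hu, hub⟩ := exists_int_smul_of_elementary A Δ hΔ y hy hAy hmin
    rcases lt_or_gt_of_ne ht with h | h
    · exact ⟨-u, -t, neg_pos.2 h, fun i => by simp [hu], fun i => by simpa using hub i⟩
    · exact ⟨u, t, h, hu, hub⟩
  obtain ⟨u, t, ht, hu, hub⟩ := key
  refine ⟨u, ?_, ?_, fun i => ?_, fun i hi => ?_, hub⟩
  · rintro rfl
    refine hy (funext fun i => ?_)
    simpa [ht.ne'] using (hu i).symm
  · have : (fun i => (u i : ℚ)) = t • y := funext hu
    rw [this, Matrix.mulVec_smul, hAy, smul_zero]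
  · rw [hu]
    nlinarith [mul_nonneg ht.le (hyx i)]
  · have := hu i
    rw [hys i hi, mul_zero] at this
    exact_mod_cast this

lemma map_intCast_mulVec_eq_zero_iff {m q : ℕ} (A : Matrix (Fin m) (Fin q) ℤ) (u : Fin q → ℤ) :
    (A.map (Int.cast : ℤ → ℚ)).mulVec (fun i => (u i : ℚ)) = 0 ↔ A.mulVec u = 0 := by
  simp only [funext_iff, Matrix.mulVec, dotProduct, Matrix.map_apply, Pi.zero_apply]
  exact forall_congr' fun i => by norm_cast

lemma abs_add_abs_eq_or_eq_zero {a b : ℚ} (h : 0 ≤ (a - b) * a) (hab : 0 ≤ a * b) :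
    |a - b| + |b| = |a| ∨ a = 0 := by
  rcases lt_trichotomy a 0 with ha | ha | ha
  · left
    have h1 : a - b ≤ 0 := nonpos_of_mul_nonneg_left h ha
    have h2 : b ≤ 0 := by by_contra! hb; nlinarith
    rw [abs_of_nonpos h1, abs_of_nonpos h2, abs_of_neg ha]; ring
  · exact Or.inr ha
  · left
    have h1 : 0 ≤ a - b := nonneg_of_mul_nonneg_left h ha
    have h2 : 0 ≤ b := by by_contra! hb; nlinarith
    rw [abs_of_nonneg h1, abs_of_nonneg h2, abs_of_pos ha]; ring

/-- A rational kernel vector conforming to a Graver element that is not itself bounded by `Δ`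
is bounded by `Δ` times the size of its support. -/
lemma abs_le_card_support_mul {m q : ℕ} (A : Matrix (Fin m) (Fin q) ℤ) (Δ : ℤ)
    (hΔ : ∀ (s : ℕ) (r : Fin s → Fin m) (c : Fin s → Fin q),
      Function.Injective r → Function.Injective c → |(A.submatrix r c).det| ≤ Δ)
    (g : Fin q → ℤ) (hg : InGraver A g) (hgΔ : ¬ ∀ i, |g i| ≤ Δ) (k : ℕ) (x : Fin q → ℚ)
    (hAx : (A.map (Int.cast : ℤ → ℚ)).mulVec x = 0) (hxg : ∀ i, 0 ≤ x i * g i)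
    (hxa : ∀ i, |x i| ≤ |(g i : ℚ)|) (hk : (Finset.univ.filter fun i => x i ≠ 0).card ≤ k)
    (i : Fin q) : |x i| ≤ k * Δ := by
  induction k generalizing x with
  | zero =>
    have : x i = 0 := by
      by_contra h
      have : (Finset.univ.filter fun i => x i ≠ 0).card = 0 := by omega
      rw [Finset.card_eq_zero, Finset.filter_eq_empty_iff] at this
      exact this (Finset.mem_univ i) h
    simp [this]
  | succ k ih =>
    have hΔ0 : 0 ≤ Δ := (abs_nonneg _).trans
      (hΔ 0 Fin.elim0 Fin.elim0 (Function.injective_of_subsingleton _)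
        (Function.injective_of_subsingleton _))
    have hΔQ : (0 : ℚ) ≤ Δ := by exact_mod_cast hΔ0
    by_cases hx : x = 0
    · simp only [hx, Pi.zero_apply, abs_zero]; positivity
    obtain ⟨u, hu, hAu, hux, hus, hub⟩ := exists_conformal_int_kernel_vector A Δ hΔ x hx hAx
    obtain ⟨j, hj⟩ := Function.ne_iff.1 hu
    obtain ⟨t, ht, hw, l, hxl, hwl⟩ := exists_sub_smul_support_lt x (fun i => (u i : ℚ))
      ⟨j, lt_of_le_of_ne (hux j) (Ne.symm (mul_ne_zero (fun h => hj (hus j h))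
        (by exact_mod_cast hj)))⟩
    have hsplit : ∀ i, |x i - t * u i| + t * |(u i : ℚ)| = |x i| := fun i => by
      rcases abs_add_abs_eq_or_eq_zero (hw i)
        (by nlinarith [mul_nonneg ht.le (hux i)] : 0 ≤ x i * (t * u i)) with h | h
      · rwa [abs_mul, abs_of_pos ht] at h
      · simp [h, hus i h]
    have hsign : ∀ i (v : ℚ), 0 ≤ v * x i → (x i = 0 → v = 0) → 0 ≤ v * g i := fun i v hv h0 => by
      by_cases h : x i = 0
      · simp [h0 h]
      · have h1 := mul_nonneg hv (hxg i)
        have h2 : 0 < x i * x i := mul_self_pos.2 h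
        exact nonneg_of_mul_nonneg_left (by linarith : 0 ≤ (v * g i) * (x i * x i)) h2
    have ht1 : t < 1 := by
      by_contra! h1
      refine hgΔ ?_
      have : u = g := hg.2.2 u hu ((map_intCast_mulVec_eq_zero_iff A u).1 hAu)
        ⟨fun i => ?_, fun i => ?_⟩
      · exact this ▸ hub
      · exact_mod_cast hsign i (u i) (by rw [mul_comm]; exact hux i)
          (fun h => by exact_mod_cast hus i h)
      · have : |(u i : ℚ)| ≤ |(g i : ℚ)| := by
          nlinarith [hsplit i, hxa i, abs_nonneg (x i - t * u i), abs_nonneg (u i : ℚ)]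
        exact_mod_cast this
    have hrec := ih (fun i => x i - t * u i) ?_ ?_ ?_ ?_
    · have hui : |(u i : ℚ)| ≤ Δ := by exact_mod_cast hub i
      have := hsplit i
      push_cast
      nlinarith [abs_nonneg (u i : ℚ)]
    · have : (fun i => x i - t * (u i : ℚ)) = x - t • fun i => (u i : ℚ) := rfl
      rw [this, Matrix.mulVec_sub, Matrix.mulVec_smul, hAx, hAu]; simp
    · exact fun i => hsign i _ (hw i) fun h => by simp [h, hus i h]
    · intro i
      have := mul_nonneg ht.le (abs_nonneg (u i : ℚ))
      linarith [hsplit i, hxa i]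
    · refine Nat.le_of_lt_succ (lt_of_lt_of_le (Finset.card_lt_card
        (Finset.ssubset_iff_of_subset ?_ |>.2 ⟨l, ?_, ?_⟩)) hk)
      · intro j
        simp only [Finset.mem_filter, Finset.mem_univ, true_and]
        exact mt fun h => by simp [h, hus j h]
      · simpa using hxl
      · simpa using hwl

/-- If `Δ` bounds the absolute values of determinants of all square submatrices of
an integer matrix `A` with `q` columns, then every Graver basis element `g` of `A`
satisfies `‖g‖_∞ ≤ q · Δ`. -/
theorem stmt_7 (m q : ℕ) (A : Matrix (Fin m) (Fin q) ℤ) (Δ : ℤ)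
    (hΔ : ∀ (s : ℕ) (r : Fin s → Fin m) (c : Fin s → Fin q),
      Function.Injective r → Function.Injective c → |(A.submatrix r c).det| ≤ Δ)
    (g : Fin q → ℤ) (hg : InGraver A g) :
    ∀ j, |g j| ≤ q * Δ := by
  intro j
  by_cases hgΔ : ∀ i, |g i| ≤ Δ
  · have hq : (1 : ℤ) ≤ q := by exact_mod_cast j.pos
    nlinarith [hgΔ j, abs_nonneg (g j)]
  · have := abs_le_card_support_mul A Δ hΔ g hg hgΔ q (fun i => (g i : ℚ))
      ((map_intCast_mulVec_eq_zero_iff A g).2 hg.2.1) (fun i => mul_self_nonneg _)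
      (fun i => le_rfl) ((Finset.card_le_univ _).trans_eq (Fintype.card_fin q)) j
    exact_mod_cast this
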